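/- arXiv:1602.02710 — 3 statements merged into one kernel-verified Lean document; each statement's English description precedes it below -/
import Mathlib

section
/- For all distinct agents i ≠ j and every issue p, the formula K_i ¬op_j(p) ↔ (¬op_j(p) ∧ vis_j(p)) holds at every state. -/
/-- A state: a profile of private opinions `B` and visibility functions `V`. -/
structure IState (N I : Type) where
  B : N → I → Bool
  V : N → I → Bool

/-- Agent `i` cannot distinguish states `S` and `S'`. -/
def indist {N I : Type} (i : N) (S S' : IState N I) : Prop :=
  S.B i = S'.B i ∧ S.V = S'.V ∧
    ∀ j, j ≠ i → ∀ p, S.V j p = true → S.B j p = S'.B j p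

/-- The epistemic layer of ELTL-I. -/
inductive EForm (N I : Type) where
  | op : N → I → EForm N I
  | vis : N → I → EForm N I
  | neg : EForm N I → EForm N I
  | conj : EForm N I → EForm N I → EForm N I
  | know : N → EForm N I → EForm N I
  deriving DecidableEq

/-- Truth of an epistemic-layer formula at a state. -/
def esat {N I : Type} : IState N I → EForm N I → Prop
  | S, .op i p => S.B i p = true
  | S, .vis i p => S.V i p = true
  | S, .neg a => ¬ esat S a
  | S, .conj a b => esat S a ∧ esat S b
  | S, .know i a => ∀ S', indist i S S' → esat S' a

/-- for `i ≠ j`, `K_i ¬op_j(p) ↔ (¬op_j(p) ∧ vis_j(p))` holds at every state. -/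
theorem know_other_negative_opinion {N I : Type} [Fintype N] [Fintype I]
    (i j : N) (hij : i ≠ j) (p : I) (S : IState N I) :
    esat S (EForm.know i (EForm.neg (EForm.op j p))) ↔
      esat S (EForm.conj (EForm.neg (EForm.op j p)) (EForm.vis j p)) := by
  classical
  simp only [esat]
  constructor
  · intro h
    refine ⟨h S ⟨rfl, rfl, fun _ _ _ _ => rfl⟩, ?_⟩
    by_contra hv
    refine h ⟨Function.update S.B j (Function.update (S.B j) p true), S.V⟩
      ⟨by simp [hij], rfl, ?_⟩ (by simp)
    intro k _ q hq
    by_cases hk : k = j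
    · subst hk
      have hqp : q ≠ p := by
        rintro rfl
        exact hv hq
      simp [hqp]
    · simp [hk]
  · rintro ⟨hop, hv⟩ S' ⟨_, _, hB⟩
    rwa [← hB j hij.symm p hv]
end

section
/- For all distinct agents i ≠ j and every epistemic-layer formula α that contains no occurrence of any epistemic operator K_l (for any agent l), the formula K_i K_j K_i α ↔ K_j K_i α holds at every state. -/
/-- `α` contains no occurrence of any epistemic operator `K_l`. -/
def EForm.kfree {N I : Type} : EForm N I → Prop
  | .op _ _ => True
  | .vis _ _ => True
  | .neg a => a.kfree
  | .conj a b => a.kfree ∧ b.kfree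
  | .know _ _ => False

theorem indist.refl {N I : Type} (i : N) (S : IState N I) : indist i S S :=
  ⟨rfl, rfl, fun _ _ _ _ => rfl⟩

/-- Indistinguishable states have the same visible opinions, of all agents. -/
theorem indist.visible_eq {N I : Type} {i : N} {S S' : IState N I} (h : indist i S S')
    (k : N) (p : I) (hv : S.V k p = true) : S.B k p = S'.B k p := by
  by_cases hk : k = i
  · rw [hk, h.1]
  · exact h.2.2 k hk p hv

/-- States with the same visibility functions and visible opinions are linked by a `j`-step
followed by an `i`-step, for any two distinct agents `i` and `j`. -/
theorem exists_indist_indist {N I : Type} {i j : N} (hij : i ≠ j) {S S' : IState N I}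
    (hV : S.V = S'.V) (hB : ∀ k p, S.V k p = true → S.B k p = S'.B k p) :
    ∃ T, indist j S T ∧ indist i T S' := by
  classical
  refine ⟨⟨Function.update S'.B j (S.B j), S.V⟩, ⟨?_, rfl, ?_⟩, ?_, hV, ?_⟩
  · simp
  · intro k hk p hv
    simpa [Function.update_of_ne hk] using hB k p hv
  · simp [Function.update_of_ne hij]
  · intro k _ p hv
    by_cases hk : k = j
    · subst hk
      simpa using hB k p hv
    · simp [Function.update_of_ne hk]

/-- for `i ≠ j` and `K`-free `α`, `K_i K_j K_i α ↔ K_j K_i α`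
holds at every state. -/
theorem know_depth_reduction {N I : Type} [Fintype N] [Fintype I]
    (i j : N) (hij : i ≠ j) (α : EForm N I) (hα : α.kfree) (S : IState N I) :
    esat S (EForm.know i (EForm.know j (EForm.know i α))) ↔
      esat S (EForm.know j (EForm.know i α)) := by
  constructor
  · intro h
    exact h S (indist.refl i S)
  · intro h S₁ h₁ S₂ h₂ S₃ h₃
    obtain ⟨T, hT, hT'⟩ := exists_indist_indist hij (h₁.2.1.trans (h₂.2.1.trans h₃.2.1))
      fun k p hv => by
        have hv₁ : S₁.V k p = true := h₁.2.1 ▸ hv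
        have hv₂ : S₂.V k p = true := h₂.2.1 ▸ hv₁
        rw [h₁.visible_eq k p hv, h₂.visible_eq k p hv₁, h₃.visible_eq k p hv₂]
    exact h T hT S₃ hT'
end

section
/- Let IG be an influence game with unanimous aggregation and let i be an agent. If there exist an agent j ≠ i and an issue p such that the goal γ_i semantically entails X vis_j(p) (i.e., every history H with H,0 ⊨ γ_i satisfies H,0 ⊨ X vis_j(p)), or γ_i semantically entails X ¬vis_j(p), then agent i has no winning strategy, for any initial state S_0: for every strategy Q_i of i there is a profile Q_{-i} of strategies of the other players such that H_{S_0,(Q_i,Q_{-i})}, 0 ⊭ γ_i. -/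
/-- Individual actions: reveal an issue, hide an issue, or do nothing. -/
inductive IAct (I : Type) where
  | reveal : I → IAct I
  | hide : I → IAct I
  | skip : IAct I

/-- Effect of an action on a visibility function. -/
def applyAct {I : Type} [DecidableEq I] (a : IAct I) (v : I → Bool) : I → Bool :=
  fun p =>
    match a with
    | .reveal q => if p = q then true else v p
    | .hide q => if p = q then false else v p
    | .skip => v p

/-- Unanimous issue-by-issue aggregation: agent `i`'s new opinion on `p`. -/
def newOp {N I : Type} [Fintype N] [DecidableEq N] (E : N → N → Bool)
    (S : IState N I) (i : N) (p : I) : Bool :=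
  let infl := Finset.univ.filter (fun j => E j i = true ∧ S.V j p = true)
  if infl = ∅ then S.B i p
  else if ∀ j ∈ infl, S.B j p = true then true
  else if ∀ j ∈ infl, S.B j p = false then false
  else S.B i p

/-- Transition function: first actions change visibility, then opinions diffuse. -/
def step {N I : Type} [Fintype N] [DecidableEq N] [DecidableEq I]
    (E : N → N → Bool) (S : IState N I) (a : N → IAct I) : IState N I :=
  let V' : N → I → Bool := fun i => applyAct (a i) (S.V i)
  let mid : IState N I := ⟨S.B, V'⟩
  ⟨fun i p => newOp E mid i p, V'⟩

/-- A history: an infinite sequence of states, each obtained from the previous by a joint action. -/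
structure History {N : Type} (I : Type) [Fintype N] [DecidableEq N] [DecidableEq I]
    (E : N → N → Bool) where
  seq : ℕ → IState N I
  isRun : ∀ t, ∃ a : N → IAct I, seq (t + 1) = step E (seq t) a

/-- Truth of an epistemic-layer formula at a history and a time. -/
def hsatE {N I : Type} [Fintype N] [DecidableEq N] [DecidableEq I] {E : N → N → Bool} :
    History I E → ℕ → EForm N I → Prop
  | H, k, .op i p => (H.seq k).B i p = true
  | H, k, .vis i p => (H.seq k).V i p = true
  | H, k, .neg a => ¬ hsatE H k a
  | H, k, .conj a b => hsatE H k a ∧ hsatE H k b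
  | H, k, .know i a => ∀ H' : History I E, indist i (H.seq k) (H'.seq k) → hsatE H' k a


/-- The temporal layer of ELTL-I. -/
inductive TForm (N I : Type) where
  | base : EForm N I → TForm N I
  | neg : TForm N I → TForm N I
  | conj : TForm N I → TForm N I → TForm N I
  | next : TForm N I → TForm N I
  | untl : TForm N I → TForm N I → TForm N I
  deriving DecidableEq

/-- Truth of an ELTL-I formula at a history and a time. -/
def hsat {N I : Type} [Fintype N] [DecidableEq N] [DecidableEq I] {E : N → N → Bool} :
    History I E → ℕ → TForm N I → Prop
  | H, k, .base a => hsatE H k a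
  | H, k, .neg f => ¬ hsat H k f
  | H, k, .conj f g => hsat H k f ∧ hsat H k g
  | H, k, .next f => hsat H (k + 1) f
  | H, k, .untl f g =>
      ∃ k', k ≤ k' ∧ hsat H k' g ∧ ∀ k'', k ≤ k'' → k'' < k' → hsat H k'' f

/-- A strategy for player `i`: a state-based choice of action that is uniform
across states that `i` cannot distinguish. -/
def IsStrategy {N I : Type} (i : N) (Q : IState N I → IAct I) : Prop :=
  ∀ S S', indist i S S' → Q S = Q S'

/-- The sequence of states induced by a strategy profile from an initial state. -/
def play {N I : Type} [Fintype N] [DecidableEq N] [DecidableEq I]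
    (E : N → N → Bool) (Q : N → IState N I → IAct I) (S₀ : IState N I) :
    ℕ → IState N I
  | 0 => S₀
  | t + 1 => step E (play E Q S₀ t) (fun i => Q i (play E Q S₀ t))

/-- The history induced by a strategy profile and an initial state. -/
def playHist {N I : Type} [Fintype N] [DecidableEq N] [DecidableEq I]
    (E : N → N → Bool) (Q : N → IState N I → IAct I) (S₀ : IState N I) :
    History I E :=
  ⟨play E Q S₀, fun t => ⟨fun i => Q i (play E Q S₀ t), rfl⟩⟩

theorem isStrategy_const {N I : Type} (i : N) (a : IAct I) : IsStrategy i (fun _ => a) :=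
  fun _ _ _ => rfl

/-- Against any strategy of `i`, the other players can all play one fixed action `a` forever. -/
theorem isStrategy_update_const {N I : Type} [DecidableEq N] {i : N}
    {Qi : IState N I → IAct I} (hQi : IsStrategy i Qi) (a : IAct I) (j : N) :
    IsStrategy j (Function.update (fun _ _ => a) i Qi j) := by
  by_cases h : j = i
  · subst h
    simpa using hQi
  · simpa [h] using isStrategy_const j a

/-- The visibility of `j` after one round is the result of `j`'s own action. -/
theorem playHist_one_V {N I : Type} [Fintype N] [DecidableEq N] [DecidableEq I]
    (E : N → N → Bool) (Q : N → IState N I → IAct I) (S₀ : IState N I) (j : N) :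
    ((playHist E Q S₀).seq 1).V j = applyAct (Q j S₀) (S₀.V j) :=
  rfl

/-- if agent `i`'s goal semantically entails `X vis_j(p)` or
`X ¬vis_j(p)` for some other agent `j` and issue `p`, then `i` has no winning
strategy, for any initial state. -/
theorem no_winning_strategy_for_visibility_goals
    {N I : Type} [Fintype N] [DecidableEq N] [Fintype I] [DecidableEq I]
    (E : N → N → Bool) (hE : ∀ i, E i i = false)
    (γ : N → TForm N I) (i : N)
    (hgoal : ∃ j : N, j ≠ i ∧ ∃ p : I,
      (∀ H : History I E, hsat H 0 (γ i) →
        hsat H 0 (TForm.next (TForm.base (EForm.vis j p)))) ∨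
      (∀ H : History I E, hsat H 0 (γ i) →
        hsat H 0 (TForm.next (TForm.base (EForm.neg (EForm.vis j p)))))) :
    ∀ S₀ : IState N I, ∀ Qi : IState N I → IAct I, IsStrategy i Qi →
      ∃ Q : N → IState N I → IAct I,
        (∀ j, IsStrategy j (Q j)) ∧ Q i = Qi ∧
        ¬ hsat (playHist E Q S₀) 0 (γ i) := by
  intro S₀ Qi hQi
  obtain ⟨j, hj, p, h | h⟩ := hgoal
  · refine ⟨Function.update (fun _ _ => IAct.hide p) i Qi, isStrategy_update_const hQi _,
      Function.update_self .., fun hsat_goal => ?_⟩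
    have hvis := h _ hsat_goal
    simp [hsat, hsatE, playHist_one_V, applyAct, hj] at hvis
  · refine ⟨Function.update (fun _ _ => IAct.reveal p) i Qi, isStrategy_update_const hQi _,
      Function.update_self .., fun hsat_goal => ?_⟩
    have hvis := h _ hsat_goal
    simp [hsat, hsatE, playHist_one_V, applyAct, hj] at hvis
end
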